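/- Let $E$ be a symmetric operator on a dense domain $\mathcal{D}$ of a Hilbert space, and let $\{d_i\}_{i\in\mathbb{N}}$, $\{\lambda_i\}_{i\in\mathbb{N}}$ be nondecreasing real sequences with $\delta_k := \sum_{i=1}^k (d_i - \lambda_i) \ge 0$ for all $k$, and suppose $\delta_k = 0$ for infinitely many $k$. If $E$ has diagonal $\{\lambda_i\}$ with respect to an orthonormal sequence $\{f_i\}_{i\in\mathbb{N}} \subset \mathcal{D}$, then there exists an orthonormal sequence $\{e_i\}_{i\in\mathbb{N}}$, with each $e_k$ in the algebraic span of $\{f_i\}$ and with the same closed linear span as $\{f_i\}$, such that $\langle E e_i, e_i\rangle = d_i$ for all $i$. -/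

import Mathlib

open scoped InnerProductSpace

section DiagonalRotation

variable {V : Type*} [NormedAddCommGroup V] [InnerProductSpace ℂ V]

/-- `q` is a real quadratic form with polarization `w`, restricted to real combinations. -/
def ExpandsAlong (q : V → ℝ) (w : V → V → ℝ) : Prop :=
  ∀ (x y : V) (c s : ℝ), q ((c : ℂ) • x + (s : ℂ) • y) = c ^ 2 * q x + s ^ 2 * q y + c * s * w x y

/-- Every value between `q x` and `q y` is attained by `q` at a rotation of the pair `(x, y)`. -/
theorem exists_rotation_eq {q : V → ℝ} {w : V → V → ℝ} (hq : ExpandsAlong q w) (x y : V) {t : ℝ}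
    (hx : q x ≤ t) (hy : t ≤ q y) :
    ∃ c s : ℝ, c ^ 2 + s ^ 2 = 1 ∧ q ((c : ℂ) • x + (s : ℂ) • y) = t ∧
      q (((-s : ℝ) : ℂ) • x + (c : ℂ) • y) = q x + q y - t := by
  have hcont : ContinuousOn (fun θ : ℝ => Real.cos θ ^ 2 * q x + Real.sin θ ^ 2 * q y
      + Real.cos θ * Real.sin θ * w x y) (Set.Icc 0 (Real.pi / 2)) := by fun_prop
  obtain ⟨θ, -, hθ⟩ := intermediate_value_Icc (by positivity) hcont
    (show t ∈ Set.Icc _ _ by simpa using ⟨hx, hy⟩)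
  have hcs := Real.cos_sq_add_sin_sq θ
  refine ⟨Real.cos θ, Real.sin θ, hcs, (hq ..).trans hθ, ?_⟩
  rw [hq]
  simp only at hθ
  linear_combination (q x + q y) * hcs - hθ

theorem Orthonormal.update_of_orthogonal {v : ℕ → V} (hv : Orthonormal ℂ v) {g : V} (j : ℕ)
    (hg : ‖g‖ = 1) (hgv : ∀ i ≠ j, ⟪g, v i⟫_ℂ = 0) : Orthonormal ℂ (Function.update v j g) := by
  refine ⟨fun i => ?_, fun i k hik => ?_⟩
  · by_cases h : i = j
    · subst h; simpa using hg
    · simpa [h] using hv.1 i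
  · by_cases h : i = j
    · subst h; simpa [Ne.symm hik] using hgv k (Ne.symm hik)
    · by_cases h' : k = j
      · subst h'; simpa [h] using inner_eq_zero_symm.1 (hgv i h)
      · simpa [h, h'] using hv.2 hik

/-- An orthonormal sequence on which `q` takes the values `lam`, together with a target diagonal
`d` that dominates `lam` in the sense of partial sums, with equality infinitely often. -/
structure DominatedDiagonal (q : V → ℝ) where
  /-- target diagonal -/
  d : ℕ → ℝ
  /-- current diagonal -/
  lam : ℕ → ℝ
  /-- current orthonormal sequence -/
  f : ℕ → V
  d_mono : Monotone d
  lam_mono : Monotone lam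
  sum_nonneg : ∀ k, 0 ≤ ∑ i ∈ Finset.range k, (d i - lam i)
  infinite_zeros : {k | ∑ i ∈ Finset.range k, (d i - lam i) = 0}.Infinite
  orthonormal : Orthonormal ℂ f
  diag : ∀ i, q (f i) = lam i

namespace DominatedDiagonal

variable {q : V → ℝ}

/-- The partial sums of `d - lam` vanish at `k`. -/
def BalancedAt (S : DominatedDiagonal q) (k : ℕ) : Prop :=
  ∑ i ∈ Finset.range k, (S.d i - S.lam i) = 0

theorem BalancedAt.exists_d_zero_le {S : DominatedDiagonal q} {k : ℕ} (h : S.BalancedAt (k + 1)) :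
    ∃ i < k + 1, S.d 0 ≤ S.lam i := by
  by_contra! hc
  refine (Finset.sum_pos (fun i hi => ?_) (by simp)).ne' h
  have h1 := hc i (Finset.mem_range.1 hi)
  have h2 := S.d_mono (Nat.zero_le i)
  linarith

theorem exists_balancedAt_gt (S : DominatedDiagonal q) (n : ℕ) : ∃ k > n, S.BalancedAt k := by
  obtain ⟨k, hk, hn⟩ := S.infinite_zeros.exists_gt n
  exact ⟨k, hn, hk⟩

/-- `T` arises from `S` by splitting off the unit vector `e` that realizes the first target. -/
structure Splits (S T : DominatedDiagonal q) (e : V) : Prop where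
  d_succ : ∀ i, T.d i = S.d (i + 1)
  norm_eq : ‖e‖ = 1
  diag_eq : q e = S.d 0
  inner_eq : ∀ i, ⟪e, T.f i⟫_ℂ = 0
  mem_span : e ∈ Submodule.span ℂ (Set.range S.f)
  f_mem_span : ∀ i, T.f i ∈ Submodule.span ℂ (Set.range S.f)
  balancedAt : ∀ k, S.BalancedAt (k + 1) → T.BalancedAt k
  span_le : ∀ k, S.BalancedAt (k + 1) → ∀ i < k + 1,
    S.f i ∈ Submodule.span ℂ (insert e (T.f '' Set.Iio k))

theorem infinite_of_balancedAt_succ (S : DominatedDiagonal q) {p : ℕ → Prop}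
    (h : ∀ k, S.BalancedAt (k + 1) → p k) : {k | p k}.Infinite := by
  refine Set.infinite_of_forall_exists_gt fun n => ?_
  obtain ⟨k, hk, hb⟩ := S.exists_balancedAt_gt (n + 1)
  obtain ⟨k, rfl⟩ : ∃ m, k = m + 1 := ⟨k - 1, by omega⟩
  exact ⟨k, h k hb, by omega⟩

/-- If the first diagonal entry already agrees with its target, split off the first vector. -/
theorem exists_splits_of_eq (S : DominatedDiagonal q) (h0 : S.d 0 = S.lam 0) :
    ∃ T e, S.Splits T e := by
  have hsum : ∀ k, ∑ i ∈ Finset.range k, (S.d (i + 1) - S.lam (i + 1))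
      = ∑ i ∈ Finset.range (k + 1), (S.d i - S.lam i) := fun k => by
    rw [Finset.sum_range_succ', h0, sub_self, add_zero]
  refine ⟨⟨fun i => S.d (i + 1), fun i => S.lam (i + 1), fun i => S.f (i + 1),
    fun a b h => S.d_mono (by omega), fun a b h => S.lam_mono (by omega),
    fun k => (hsum k).symm ▸ S.sum_nonneg _,
    S.infinite_of_balancedAt_succ fun k hk => (hsum k).trans hk,
    S.orthonormal.comp _ (add_left_injective 1), fun i => S.diag _⟩, S.f 0,
    fun i => rfl, S.orthonormal.1 0, (S.diag 0).trans h0.symm,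
    fun i => S.orthonormal.2 (by simp), Submodule.subset_span ⟨0, rfl⟩,
    fun i => Submodule.subset_span ⟨_, rfl⟩, fun k hk => (hsum k).trans hk, fun k _ i hi => ?_⟩
  apply Submodule.subset_span
  rcases i with _ | i
  · exact Set.mem_insert _ _
  · exact Set.mem_insert_of_mem _ ⟨i, by simpa using hi, rfl⟩

/-- The sequence `u` with the entries `j` and `j + 1` merged into the single entry `a`. -/
def mergeAt {α : Type*} (u : ℕ → α) (j : ℕ) (a : α) : ℕ → α :=
  Function.update (fun i => u (if i < j then i else i + 1)) j a

section mergeAt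

variable {α : Type*} (u : ℕ → α) {j i : ℕ} (a : α)

theorem mergeAt_of_lt (h : i < j) : mergeAt u j a i = u i := by
  simp [mergeAt, h, h.ne]

theorem mergeAt_self : mergeAt u j a j = a := by simp [mergeAt]

theorem mergeAt_of_gt (h : j < i) : mergeAt u j a i = u (i + 1) := by
  simp [mergeAt, h.ne', h.not_gt]

theorem sum_range_mergeAt (u : ℕ → ℝ) {k : ℕ} (t : ℝ) (h : j < k) :
    ∑ i ∈ Finset.range k, mergeAt u j (u j + u (j + 1) - t) i
      = ∑ i ∈ Finset.range (k + 1), u i - t := by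
  induction k, h using Nat.le_induction with
  | base =>
    rw [Finset.sum_range_succ, mergeAt_self, Finset.sum_range_succ, Finset.sum_range_succ,
      Finset.sum_congr rfl fun i hi => mergeAt_of_lt u _ (Finset.mem_range.1 hi)]
    ring
  | succ k hk ih =>
    rw [Finset.sum_range_succ, ih, mergeAt_of_gt u _ hk, Finset.sum_range_succ _ (k + 1)]
    ring

theorem monotone_mergeAt {u : ℕ → ℝ} (hu : Monotone u) {a : ℝ} (h1 : u j ≤ a)
    (h2 : a ≤ u (j + 1)) : Monotone (mergeAt u j a) := by
  refine monotone_nat_of_le_succ fun i => ?_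
  rcases lt_trichotomy i j with h | rfl | h
  · rw [mergeAt_of_lt u a h]
    rcases (Nat.succ_le_of_lt h).lt_or_eq with h' | rfl
    · rw [mergeAt_of_lt u a h']; exact hu (by omega)
    · rw [mergeAt_self]; exact (hu (by omega)).trans h1
  · rw [mergeAt_self, mergeAt_of_gt u a (by omega)]; exact h2.trans (hu (by omega))
  · rw [mergeAt_of_gt u a h, mergeAt_of_gt u a (by omega)]; exact hu (by omega)

end mergeAt

/-- If `lam j < d 0 ≤ lam (j + 1)`, rotating the vectors `j` and `j + 1` realizes the first
target. -/
theorem exists_splits_of_lt {w : V → V → ℝ} (hq : ExpandsAlong q w) (S : DominatedDiagonal q)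
    {j : ℕ} (hj : S.lam j < S.d 0) (hj' : S.d 0 ≤ S.lam (j + 1)) : ∃ T e, S.Splits T e := by
  obtain ⟨c, s, hcs, he, hg⟩ := exists_rotation_eq hq (S.f j) (S.f (j + 1))
    (t := S.d 0) (by rw [S.diag]; exact hj.le) (by rw [S.diag]; exact hj')
  rw [S.diag, S.diag] at hg
  set e := (c : ℂ) • S.f j + (s : ℂ) • S.f (j + 1) with he_def
  set g := ((-s : ℝ) : ℂ) • S.f j + (c : ℂ) • S.f (j + 1) with hg_def
  have hcs' : (c : ℂ) ^ 2 + (s : ℂ) ^ 2 = 1 := by exact_mod_cast hcs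
  have hff := orthonormal_iff_ite.1 S.orthonormal
  have hinner : ∀ a b a' b' : ℝ, ⟪(a : ℂ) • S.f j + (b : ℂ) • S.f (j + 1),
      (a' : ℂ) • S.f j + (b' : ℂ) • S.f (j + 1)⟫_ℂ = ((a * a' + b * b' : ℝ) : ℂ) :=
    fun a b a' b' => by
      simp only [inner_add_left, inner_add_right, inner_smul_left, inner_smul_right, hff,
        Complex.conj_ofReal, if_true, Nat.succ_ne_self, (Nat.succ_ne_self j).symm, if_false]
      push_cast
      ring
  have hnorm : ∀ a b : ℝ, a ^ 2 + b ^ 2 = 1 →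
      ‖(a : ℂ) • S.f j + (b : ℂ) • S.f (j + 1)‖ = 1 := fun a b hab => by
    rw [← sq_eq_sq₀ (norm_nonneg _) zero_le_one, @norm_sq_eq_re_inner ℂ, hinner]
    simp only [Complex.ofReal_re, RCLike.re_to_complex]
    linear_combination hab
  have hee : ‖e‖ = 1 := hnorm _ _ hcs
  have hgg : ‖g‖ = 1 := hnorm _ _ (by linear_combination hcs)
  have heg : ⟪e, g⟫_ℂ = 0 := (hinner _ _ _ _).trans (by push_cast; ring)
  have hpair : ∀ (a b : ℂ) (i : ℕ), i ≠ j → i ≠ j + 1 →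
      ⟪a • S.f j + b • S.f (j + 1), S.f i⟫_ℂ = 0 := fun a b i h1 h2 => by
    simp [hff, h1.symm, h2.symm]
  have hshift : ∀ i ≠ j, (if i < j then i else i + 1) ≠ j ∧ (if i < j then i else i + 1) ≠ j + 1 :=
    fun i hi => by split_ifs <;> omega
  have hinj : Function.Injective fun i => if i < j then i else i + 1 := fun a b h => by
    simp only at h; split_ifs at h <;> omega
  have hfj : S.f j = (c : ℂ) • e + ((-s : ℝ) : ℂ) • g := by
    rw [he_def, hg_def]
    push_cast
    linear_combination (norm := module) (-hcs') • S.f j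
  have hfj' : S.f (j + 1) = (s : ℂ) • e + (c : ℂ) • g := by
    rw [he_def, hg_def]
    push_cast
    linear_combination (norm := module) (-hcs') • S.f (j + 1)
  have hmem : ∀ a b : ℂ, a • S.f j + b • S.f (j + 1) ∈ Submodule.span ℂ (Set.range S.f) :=
    fun a b => add_mem (Submodule.smul_mem _ _ (Submodule.subset_span ⟨_, rfl⟩))
      (Submodule.smul_mem _ _ (Submodule.subset_span ⟨_, rfl⟩))
  set lam' := mergeAt S.lam j (S.lam j + S.lam (j + 1) - S.d 0)
  set f' := mergeAt S.f j g
  have hsum : ∀ k, j < k → ∑ i ∈ Finset.range k, (S.d (i + 1) - lam' i)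
      = ∑ i ∈ Finset.range (k + 1), (S.d i - S.lam i) := fun k hk => by
    rw [Finset.sum_sub_distrib, sum_range_mergeAt _ _ hk, Finset.sum_sub_distrib,
      Finset.sum_range_succ' S.d]
    ring
  have hlt : ∀ k, S.BalancedAt (k + 1) → j < k := fun k hk => by
    obtain ⟨i, hi, hdi⟩ := hk.exists_d_zero_le
    by_contra! h
    exact (hdi.trans (S.lam_mono (by omega))).not_gt hj
  have hbal : ∀ k, S.BalancedAt (k + 1) → ∑ i ∈ Finset.range k, (S.d (i + 1) - lam' i) = 0 :=
    fun k hk => (hsum k (hlt k hk)).trans hk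
  have hpos : ∀ k, 0 ≤ ∑ i ∈ Finset.range k, (S.d (i + 1) - lam' i) := fun k => by
    rcases lt_or_ge j k with h | h
    · rw [hsum k h]; exact S.sum_nonneg _
    · refine Finset.sum_nonneg fun i hi => ?_
      have hij : i < j := (Finset.mem_range.1 hi).trans_le h
      rw [show lam' i = S.lam i from mergeAt_of_lt _ _ hij]
      linarith [S.d_mono (Nat.zero_le (i + 1)), S.lam_mono hij.le]
  have hdiag : ∀ i, q (f' i) = lam' i := fun i => by
    rcases lt_trichotomy i j with h | rfl | h
    · simp only [f', lam', mergeAt_of_lt _ _ h, S.diag]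
    · simp only [f', lam', mergeAt_self, hg]
    · simp only [f', lam', mergeAt_of_gt _ _ h, S.diag]
  refine ⟨⟨fun i => S.d (i + 1), lam', f', fun a b h => S.d_mono (by omega),
    monotone_mergeAt S.lam_mono (by linarith) (by linarith), hpos,
    S.infinite_of_balancedAt_succ hbal,
    (S.orthonormal.comp _ hinj).update_of_orthogonal j hgg
      fun i hi => hpair _ _ _ (hshift i hi).1 (hshift i hi).2, hdiag⟩, e,
    fun i => rfl, hee, he, fun i => ?_, hmem _ _, fun i => ?_, hbal, fun k hk i hi => ?_⟩
  · rcases lt_trichotomy i j with h | rfl | h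
    · simpa only [f', mergeAt_of_lt _ _ h] using hpair _ _ i (by omega) (by omega)
    · simpa only [f', mergeAt_self] using heg
    · simpa only [f', mergeAt_of_gt _ _ h] using hpair _ _ (i + 1) (by omega) (by omega)
  · rcases lt_trichotomy i j with h | rfl | h
    · simp only [f', mergeAt_of_lt _ _ h]; exact Submodule.subset_span ⟨_, rfl⟩
    · simp only [f', mergeAt_self]; exact hmem _ _
    · simp only [f', mergeAt_of_gt _ _ h]; exact Submodule.subset_span ⟨_, rfl⟩
  · have hjk := hlt k hk
    have hcomb : ∀ a b : ℂ, a • e + b • g ∈ Submodule.span ℂ (insert e (f' '' Set.Iio k)) :=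
      fun a b => add_mem
        (Submodule.smul_mem _ _ (Submodule.subset_span (Set.mem_insert _ _)))
        (Submodule.smul_mem _ _ (Submodule.subset_span
          (Set.mem_insert_of_mem _ ⟨j, hjk, mergeAt_self _ _⟩)))
    rcases lt_trichotomy i j with h | rfl | h
    · exact Submodule.subset_span
        (Set.mem_insert_of_mem _ ⟨i, h.trans hjk, mergeAt_of_lt _ _ h⟩)
    · rw [hfj]; exact hcomb _ _
    · obtain ⟨m, rfl⟩ : ∃ m, i = m + 1 := ⟨i - 1, by omega⟩
      rcases (Nat.lt_succ_iff.1 h).lt_or_eq with h' | rfl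
      · exact Submodule.subset_span
          (Set.mem_insert_of_mem _ ⟨m, Nat.lt_of_succ_lt_succ hi, mergeAt_of_gt _ _ h'⟩)
      · rw [hfj']; exact hcomb _ _

theorem exists_splits {w : V → V → ℝ} (hq : ExpandsAlong q w) (S : DominatedDiagonal q) :
    ∃ T e, S.Splits T e := by
  classical
  have hex : ∃ i, S.d 0 ≤ S.lam i := by
    obtain ⟨k, hk, hb⟩ := S.exists_balancedAt_gt 0
    obtain ⟨k, rfl⟩ : ∃ m, k = m + 1 := ⟨k - 1, by omega⟩
    obtain ⟨i, -, hi⟩ := hb.exists_d_zero_le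
    exact ⟨i, hi⟩
  have hle := Nat.find_spec hex
  rcases hn : Nat.find hex with _ | j
  · rw [hn] at hle
    have h1 := S.sum_nonneg 1
    rw [Finset.sum_range_one] at h1
    exact S.exists_splits_of_eq (by linarith)
  · rw [hn] at hle
    exact S.exists_splits_of_lt hq (not_le.1 (Nat.find_min hex (by omega : j < _))) hle

/-- Splitting off vectors repeatedly yields an orthonormal sequence realizing the targets. -/
theorem exists_orthonormal {w : V → V → ℝ} (hq : ExpandsAlong q w) (S : DominatedDiagonal q) :
    ∃ e : ℕ → V, Orthonormal ℂ e ∧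
      Submodule.span ℂ (Set.range e) = Submodule.span ℂ (Set.range S.f) ∧
      ∀ i, q (e i) = S.d i := by
  choose next vec hnext using fun T : DominatedDiagonal q => T.exists_splits hq
  let R : ℕ → DominatedDiagonal q := fun n => next^[n] S
  have hR : ∀ n, (R n).Splits (R (n + 1)) (vec (R n)) := fun n => by
    simp only [R, Function.iterate_succ_apply']; exact hnext _
  have hd : ∀ n i, (R n).d i = S.d (n + i) := fun n => by
    induction n with
    | zero => intro i; simp [R]
    | succ n ih => intro i; rw [(hR n).d_succ, ih]; congr 1; omega
  have hanti : Antitone fun n => Submodule.span ℂ (Set.range (R n).f) :=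
    antitone_nat_of_succ_le fun n => Submodule.span_le.2 <| by
      rintro _ ⟨i, rfl⟩; exact (hR n).f_mem_span i
  have horth : ∀ m n, m < n → ⟪vec (R m), vec (R n)⟫_ℂ = 0 := fun m n hmn => by
    have hmem := hanti (Nat.succ_le_of_lt hmn) (hR n).mem_span
    refine Submodule.mem_orthogonal_singleton_iff_inner_right.1
      ((Submodule.span_le (p := (ℂ ∙ vec (R m))ᗮ)).2 ?_ hmem)
    rintro _ ⟨i, rfl⟩
    exact Submodule.mem_orthogonal_singleton_iff_inner_right.2 ((hR m).inner_eq i)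
  have hspan : ∀ k n, (R n).BalancedAt k → ∀ i < k,
      (R n).f i ∈ Submodule.span ℂ (Set.range fun n => vec (R n)) := fun k => by
    induction k with
    | zero => intro n _ i hi; omega
    | succ k ih =>
      intro n hk i hi
      refine Submodule.span_le.2 ?_ ((hR n).span_le k hk i hi)
      rintro _ (rfl | ⟨m, hm, rfl⟩)
      · exact Submodule.subset_span ⟨n, rfl⟩
      · exact ih (n + 1) ((hR n).balancedAt k hk) m hm
  refine ⟨fun n => vec (R n), ⟨fun n => (hR n).norm_eq, fun m n hmn => ?_⟩,
    le_antisymm (Submodule.span_le.2 ?_) (Submodule.span_le.2 ?_), fun i => ?_⟩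
  · rcases hmn.lt_or_gt with h | h
    · exact horth m n h
    · exact inner_eq_zero_symm.1 (horth n m h)
  · rintro _ ⟨n, rfl⟩
    exact hanti (Nat.zero_le n) (hR n).mem_span
  · rintro _ ⟨i, rfl⟩
    obtain ⟨k, hk, hb⟩ := S.exists_balancedAt_gt i
    exact hspan k 0 hb i hk
  · rw [(hR i).diag_eq, hd, add_zero]

end DominatedDiagonal

end DiagonalRotation

/-- If $\{d_i\}, \{\lambda_i\}$ are nondecreasing with
$\delta_k = \sum_{i<k}(d_i - \lambda_i) \ge 0$ for all $k$ and $\delta_k = 0$ for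
infinitely many $k$, and the symmetric operator $E$ has diagonal $\{\lambda_i\}$
w.r.t. an orthonormal sequence $\{f_i\}$ in its dense domain, then $E$ has diagonal
$\{d_i\}$ w.r.t. an orthonormal sequence $\{e_i\}$ with the same closed span,
each $e_k$ in the algebraic span of the $f_i$. -/
theorem stmt_7 {H : Type*} [NormedAddCommGroup H] [InnerProductSpace ℂ H] [CompleteSpace H]
    (D : Submodule ℂ H) (hD : Dense (D : Set H)) (E : D →ₗ[ℂ] H)
    (hsym : ∀ f g : D, ⟪E f, (g : H)⟫_ℂ = ⟪(f : H), E g⟫_ℂ)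
    (d lam : ℕ → ℝ) (hd : Monotone d) (hlam : Monotone lam)
    (hδ : ∀ k, 0 ≤ ∑ i ∈ Finset.range k, (d i - lam i))
    (hinf : {k | ∑ i ∈ Finset.range k, (d i - lam i) = 0}.Infinite)
    (f : ℕ → D) (hf : Orthonormal ℂ fun i => (f i : H))
    (hfd : ∀ i, ⟪(f i : H), E (f i)⟫_ℂ = (lam i : ℂ)) :
    ∃ e : ℕ → D, Orthonormal ℂ (fun i => (e i : H)) ∧
      (∀ k, (e k : H) ∈ Submodule.span ℂ (Set.range fun i => (f i : H))) ∧
      (Submodule.span ℂ (Set.range fun i => (e i : H))).topologicalClosure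
        = (Submodule.span ℂ (Set.range fun i => (f i : H))).topologicalClosure ∧
      ∀ i, ⟪(e i : H), E (e i)⟫_ℂ = (d i : ℂ) := by
  have hq : ExpandsAlong (fun x : D => (⟪(x : H), E x⟫_ℂ).re)
      (fun x y => (⟪(x : H), E y⟫_ℂ).re + (⟪(y : H), E x⟫_ℂ).re) := fun x y c s => by
    simp
    ring
  have hcoe : ∀ v : ℕ → D, (Submodule.span ℂ (Set.range fun i => (v i : H)))
      = (Submodule.span ℂ (Set.range v)).map D.subtype := fun v => by
    rw [Submodule.map_span, ← Set.range_comp]; rfl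
  obtain ⟨e, he, hspan, hdiag⟩ := DominatedDiagonal.exists_orthonormal hq
    ⟨d, lam, f, hd, hlam, hδ, hinf, (D.subtypeₗᵢ.orthonormal_comp_iff).1 hf,
      fun i => by simp [hfd i]⟩
  have hspan' : Submodule.span ℂ (Set.range fun i => (e i : H))
      = Submodule.span ℂ (Set.range fun i => (f i : H)) := by rw [hcoe, hcoe, hspan]
  refine ⟨e, he.comp_linearIsometry D.subtypeₗᵢ, fun k => ?_, by rw [hspan'], fun i => ?_⟩
  · rw [← hspan']; exact Submodule.subset_span ⟨k, rfl⟩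
  · have hre : (⟪(e i : H), E (e i)⟫_ℂ).re = d i := hdiag i
    rw [← hre]
    refine (Complex.conj_eq_iff_re.1 ?_).symm
    rw [inner_conj_symm]
    exact hsym _ _
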